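/- Let I ⊆ R be a monomial ideal and m ≥ 2 an integer. Then for every k ≥ 1, Ass(R/(I^[m])^k) = Ass(R/I^k); consequently the index of stability of I^[m] equals the index of stability of I. -/

import Mathlib

/-- The `m`-th square power `f^[m] = f(X_1^m, …, X_n^m)` of a polynomial `f`. -/
noncomputable def sqPoly {n : ℕ} {K : Type*} [Field K] (m : ℕ)
    (f : MvPolynomial (Fin n) K) : MvPolynomial (Fin n) K :=
  MvPolynomial.aeval (fun i => (MvPolynomial.X i : MvPolynomial (Fin n) K) ^ m) f

/-- The `m`-th square power `I^[m] = ⟨f^[m] : f ∈ I⟩` of an ideal `I`. -/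
noncomputable def sqPow {n : ℕ} {K : Type*} [Field K] (m : ℕ)
    (I : Ideal (MvPolynomial (Fin n) K)) : Ideal (MvPolynomial (Fin n) K) :=
  I.map (MvPolynomial.aeval (fun i => (MvPolynomial.X i : MvPolynomial (Fin n) K) ^ m))
/-- A monomial ideal: an ideal generated by a set of monomials `X^a`. -/
def IsMonomialIdeal {n : ℕ} {K : Type*} [Field K] (I : Ideal (MvPolynomial (Fin n) K)) : Prop :=
  ∃ A : Set (Fin n →₀ ℕ), I = Ideal.span ((fun a => (MvPolynomial.monomial a (1 : K))) '' A)
/-- The index of stability of `I`: the least `s₀ ≥ 1` such that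
`Ass(R/I^s) = Ass(R/I^{s₀})` for all `s ≥ s₀`. -/
noncomputable def stabIndex {R : Type*} [CommRing R] (I : Ideal R) : ℕ :=
  sInf {s₀ : ℕ | 0 < s₀ ∧ ∀ s : ℕ, s₀ ≤ s →
    associatedPrimes R (R ⧸ I ^ s) = associatedPrimes R (R ⧸ I ^ s₀)}

section MonomialIdeals

open MvPolynomial
open scoped Pointwise

variable {n : ℕ} {K : Type*} [Field K] {I J P : Ideal (MvPolynomial (Fin n) K)}

/-- An ideal is monomial iff it contains the monomials in the support of each of its elements. -/
theorem isMonomialIdeal_iff :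
    IsMonomialIdeal I ↔ ∀ f ∈ I, ∀ a ∈ f.support, monomial a (1 : K) ∈ I := by
  constructor
  · rintro ⟨A, rfl⟩ f hf a ha
    rw [mem_ideal_span_monomial_image] at hf ⊢
    intro b hb
    rw [Finset.mem_singleton.mp (support_monomial_subset hb)]
    exact hf a ha
  · intro h
    refine ⟨{a | monomial a (1 : K) ∈ I}, le_antisymm (fun f hf => ?_) (Ideal.span_le.mpr ?_)⟩
    · rw [mem_ideal_span_monomial_image]
      exact fun a ha => ⟨a, h f hf a ha, le_rfl⟩
    · rintro _ ⟨a, ha, rfl⟩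
      exact ha

theorem mem_of_monomial_mem {f : MvPolynomial (Fin n) K}
    (h : ∀ a ∈ f.support, monomial a (1 : K) ∈ I) : f ∈ I := by
  rw [f.as_sum]
  refine I.sum_mem fun a ha => ?_
  simpa [C_mul_monomial] using I.mul_mem_left (C (f.coeff a)) (h a ha)

theorem IsMonomialIdeal.mem_iff (hI : IsMonomialIdeal I) {f : MvPolynomial (Fin n) K} :
    f ∈ I ↔ ∀ a ∈ f.support, monomial a (1 : K) ∈ I :=
  ⟨fun hf => isMonomialIdeal_iff.mp hI f hf, mem_of_monomial_mem⟩

theorem IsMonomialIdeal.mul (hI : IsMonomialIdeal I) (hJ : IsMonomialIdeal J) :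
    IsMonomialIdeal (I * J) := by
  obtain ⟨A, rfl⟩ := hI
  obtain ⟨B, rfl⟩ := hJ
  refine ⟨A + B, ?_⟩
  rw [Ideal.span_mul_span', ← Set.image2_mul, ← Set.image2_add, Set.image_image2,
    Set.image2_image_left, Set.image2_image_right]
  simp [monomial_mul]

theorem IsMonomialIdeal.pow (hI : IsMonomialIdeal I) (k : ℕ) : IsMonomialIdeal (I ^ k) := by
  induction k with
  | zero => exact ⟨{0}, by simp [Ideal.one_eq_top]⟩
  | succ k ih => exact pow_succ I k ▸ ih.mul hI

theorem sqPow_span (m : ℕ) (A : Set (Fin n →₀ ℕ)) :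
    sqPow m (Ideal.span ((fun a => monomial a (1 : K)) '' A)) =
      Ideal.span ((fun a => monomial a (1 : K)) '' ((fun a => m • a) '' A)) := by
  rw [sqPow, Ideal.map_span, Set.image_image, Set.image_image]
  congr 1
  exact Set.image_congr fun a _ => expand_monomial m a 1

theorem IsMonomialIdeal.sqPow (hI : IsMonomialIdeal I) (m : ℕ) : IsMonomialIdeal (sqPow m I) := by
  obtain ⟨A, rfl⟩ := hI
  exact ⟨_, sqPow_span m A⟩

/-- A monomial `X^c` lies in `I^[m]` iff `X^⌊c/m⌋` lies in `I`. -/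
theorem IsMonomialIdeal.monomial_mem_sqPow_iff (hI : IsMonomialIdeal I) {m : ℕ} (hm : 0 < m)
    (c : Fin n →₀ ℕ) : monomial c (1 : K) ∈ _root_.sqPow m I ↔
      monomial (c.mapRange (· / m) (Nat.zero_div m)) (1 : K) ∈ I := by
  obtain ⟨A, rfl⟩ := hI
  rw [sqPow_span, mem_ideal_span_monomial_image, mem_ideal_span_monomial_image]
  simp [-Set.image_smul, Finsupp.le_def, Nat.le_div_iff_mul_le hm, mul_comm]

/-- A prime ideal of the form `J : f`, with `J` monomial, is monomial. -/
theorem exists_monomial_mem_of_colon (hJ : IsMonomialIdeal J) (hP : P.IsPrime)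
    {f g : MvPolynomial (Fin n) K} (hf : ∀ h, h ∈ P ↔ h * f ∈ J) (hg : g ∈ P) (hg0 : g ≠ 0) :
    ∃ a ∈ g.support, monomial a (1 : K) ∈ P := by
  induction hk : f.support.card using Nat.strong_induction_on generalizing f with
  | _ k ih =>
  have hf0 : f ≠ 0 := by
    rintro rfl
    exact hP.ne_top ((Ideal.eq_top_iff_one P).mpr ((hf 1).mpr (by simp)))
  obtain ⟨a, ha, b, hb, hab⟩ := UniqueSums.uniqueAdd_of_nonempty
    (support_nonempty.mpr hg0) (support_nonempty.mpr hf0)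
  by_contra! hcon
  have hmem : monomial (a + b) (1 : K) ∈ J := by
    refine isMonomialIdeal_iff.mp hJ _ ((hf g).mp hg) _ (mem_support_iff.mpr ?_)
    rw [show (g * f).coeff (a + b) = g.coeff a * f.coeff b from
      AddMonoidAlgebra.coeff_mul_add_of_uniqueAdd hab]
    exact mul_ne_zero (mem_support_iff.mp ha) (mem_support_iff.mp hb)
  have hsub : (f - monomial b (f.coeff b)).support ⊆ f.support.erase b := by
    intro c hc
    rw [mem_support_iff, coeff_sub, coeff_monomial] at hc
    rw [Finset.mem_erase, mem_support_iff]
    grind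
  refine absurd ?_ (not_exists.mpr fun a => not_and.mpr (hcon a))
  refine ih _ ?_ (f := monomial a 1 * (f - monomial b (f.coeff b))) (fun h => ?_) rfl
  · classical
    calc _ ≤ ((monomial a (1 : K)).support + (f - monomial b (f.coeff b)).support).card :=
          Finset.card_le_card (support_mul _ _)
      _ ≤ 1 * (f.support.erase b).card :=
          Finset.card_add_le.trans (Nat.mul_le_mul
            ((Finset.card_le_card support_monomial_subset).trans (Finset.card_singleton a).le)
            (Finset.card_le_card hsub))
      _ < k := by
          rw [one_mul, ← hk]
          exact Finset.card_erase_lt_of_mem hb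
  · have hterm : h * (monomial a 1 * monomial b (f.coeff b)) ∈ J := by
      refine J.mul_mem_left h ?_
      simpa [monomial_mul, C_mul_monomial] using J.mul_mem_left (C (f.coeff b)) hmem
    have hsplit : h * (monomial a 1 * (f - monomial b (f.coeff b))) =
        h * monomial a 1 * f - h * (monomial a 1 * monomial b (f.coeff b)) := by ring
    rw [hsplit, J.sub_mem_iff_left hterm, ← hf, hP.mul_mem_iff_mem_or_mem,
      or_iff_left (hcon a ha)]

theorem isMonomialIdeal_of_colon (hJ : IsMonomialIdeal J) (hP : P.IsPrime)
    {f : MvPolynomial (Fin n) K} (hf : ∀ h, h ∈ P ↔ h * f ∈ J) : IsMonomialIdeal P := by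
  refine isMonomialIdeal_iff.mpr fun g hg => ?_
  induction hk : g.support.card using Nat.strong_induction_on generalizing g with
  | _ k ih =>
  intro c hc
  obtain ⟨a, ha, haP⟩ := exists_monomial_mem_of_colon hJ hP hf hg (support_nonempty.mp ⟨c, hc⟩)
  by_cases hca : c = a
  · rwa [hca]
  have hsub : (g - monomial a (g.coeff a)).support ⊆ g.support.erase a := by
    intro c hc
    rw [mem_support_iff, coeff_sub, coeff_monomial] at hc
    rw [Finset.mem_erase, mem_support_iff]
    grind
  refine ih _ ?_ (g - monomial a (g.coeff a)) (P.sub_mem hg ?_) rfl c ?_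
  · rw [← hk]
    exact (Finset.card_le_card hsub).trans_lt (Finset.card_erase_lt_of_mem ha)
  · simpa [C_mul_monomial] using P.mul_mem_left (C (g.coeff a)) haP
  · rw [mem_support_iff] at hc ⊢
    simpa [coeff_monomial, Ne.symm hca] using hc

theorem mem_associatedPrimes_quotient_iff {R : Type*} [CommRing R] [IsNoetherianRing R]
    {J P : Ideal R} : P ∈ associatedPrimes R (R ⧸ J) ↔
      P.IsPrime ∧ ∃ f, ∀ h, h ∈ P ↔ h * f ∈ J := by
  rw [AssociatedPrimes.mem_iff, isAssociatedPrime_iff, and_congr_right_iff]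
  refine fun _ => Ideal.Quotient.mk_surjective.exists.trans (exists_congr fun f => ?_)
  rw [Ideal.ext_iff]
  refine forall_congr' fun h => ?_
  rw [Submodule.mem_colon_singleton, Submodule.mem_bot, Algebra.smul_def,
    Ideal.Quotient.algebraMap_eq, ← map_mul, Ideal.Quotient.eq_zero_iff_mem]

/-- The associated primes of a monomial ideal `J` are the monomial primes of the form `J : X^b`. -/
theorem IsMonomialIdeal.mem_associatedPrimes_iff (hJ : IsMonomialIdeal J) :
    P ∈ associatedPrimes (MvPolynomial (Fin n) K) (MvPolynomial (Fin n) K ⧸ J) ↔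
      P.IsPrime ∧ IsMonomialIdeal P ∧ ∃ b, ∀ a, monomial a (1 : K) ∈ P ↔ monomial (a + b) (1 : K) ∈ J := by
  rw [mem_associatedPrimes_quotient_iff]
  refine and_congr_right fun hP => ⟨?_, ?_⟩
  · rintro ⟨f, hf⟩
    have hPm := isMonomialIdeal_of_colon hJ hP hf
    refine ⟨hPm, ?_⟩
    have hmem : ∀ a, monomial a (1 : K) ∈ P ↔ ∀ b ∈ f.support, monomial (a + b) (1 : K) ∈ J := by
      intro a
      rw [hf]
      refine ⟨fun h b hb => isMonomialIdeal_iff.mp hJ _ h _ ?_, fun h => ?_⟩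
      · rw [mem_support_iff, coeff_monomial_mul, one_mul]
        exact mem_support_iff.mp hb
      · rw [f.as_sum, Finset.mul_sum]
        refine J.sum_mem fun b hb => ?_
        simpa [monomial_mul, C_mul_monomial] using J.mul_mem_left (C (f.coeff b)) (h b hb)
    by_contra! hcon
    have hex : ∀ b ∈ f.support, ∃ a, monomial a (1 : K) ∉ P ∧ monomial (a + b) (1 : K) ∈ J := by
      intro b hb
      obtain ⟨a, ha | ha⟩ := hcon b
      · exact absurd ((hmem a).mp ha.1 b hb) ha.2
      · exact ⟨a, ha⟩
    choose! e heP heJ using hex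
    have hsum : monomial (∑ b ∈ f.support, e b) (1 : K) ∈ P := by
      refine (hmem _).mpr fun b hb => ?_
      rw [← Finset.add_sum_erase _ _ hb, add_right_comm]
      simpa [monomial_mul] using
        J.mul_mem_right (monomial (∑ x ∈ f.support.erase b, e x) 1) (heJ b hb)
    rw [monomial_sum_one, hP.prod_mem_iff] at hsum
    obtain ⟨b, hb, hbP⟩ := hsum
    exact heP b hb hbP
  · rintro ⟨hPm, b, hb⟩
    refine ⟨monomial b 1, fun h => ?_⟩
    rw [hPm.mem_iff, hJ.mem_iff]
    constructor
    · intro H c hc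
      rw [mem_support_iff, coeff_mul_monomial'] at hc
      obtain ⟨hbc, hc⟩ := ite_ne_right_iff.mp hc
      rw [← tsub_add_cancel_of_le hbc, ← hb]
      exact H _ (mem_support_iff.mpr (by simpa using hc))
    · intro H a ha
      refine (hb a).mpr (H _ ?_)
      rw [mem_support_iff, coeff_mul_monomial, mul_one]
      exact mem_support_iff.mp ha

/-- Whether a prime ideal contains a monomial depends only on the support of its exponent. -/
theorem monomial_mem_iff_of_isPrime (hP : P.IsPrime) (a : Fin n →₀ ℕ) :
    monomial a (1 : K) ∈ P ↔ ∃ i ∈ a.support, (X i : MvPolynomial (Fin n) K) ∈ P := by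
  rw [monomial_eq, C_1, one_mul, Finsupp.prod, hP.prod_mem_iff]
  exact exists_congr fun i => and_congr_right fun hi =>
    hP.pow_mem_iff_mem _ (Nat.pos_of_ne_zero (Finsupp.mem_support_iff.mp hi))

theorem IsMonomialIdeal.associatedPrimes_sqPow (hJ : IsMonomialIdeal J) {m : ℕ} (hm : 0 < m) :
    associatedPrimes (MvPolynomial (Fin n) K) (MvPolynomial (Fin n) K ⧸ _root_.sqPow m J) =
      associatedPrimes (MvPolynomial (Fin n) K) (MvPolynomial (Fin n) K ⧸ J) := by
  ext P
  rw [(hJ.sqPow m).mem_associatedPrimes_iff, hJ.mem_associatedPrimes_iff]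
  refine and_congr_right fun hP => and_congr_right fun _ => ⟨?_, ?_⟩
  · rintro ⟨c, hc⟩
    refine ⟨c.mapRange (· / m) (Nat.zero_div m), fun a => ?_⟩
    have hsupp : (m • a).support = a.support := Finsupp.support_smul_eq hm.ne'
    rw [monomial_mem_iff_of_isPrime hP, ← hsupp, ← monomial_mem_iff_of_isPrime hP, hc,
      hJ.monomial_mem_sqPow_iff hm]
    refine iff_of_eq (congrArg (fun d => monomial d (1 : K) ∈ J) ?_)
    ext i
    simp [Nat.mul_add_div hm]
  · rintro ⟨b, hb⟩
    refine ⟨m • b + Finsupp.equivFunOnFinite.symm fun _ => m - 1, fun c => ?_⟩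
    have hzero : (0 + (m - 1)) / m = 0 := Nat.div_eq_of_lt (by omega)
    have hsupp : (c.mapRange (fun x => (x + (m - 1)) / m) hzero).support = c.support := by
      ext i
      simp only [Finsupp.mem_support_iff, Finsupp.mapRange_apply, ne_eq, Nat.div_eq_zero_iff]
      omega
    rw [monomial_mem_iff_of_isPrime hP, ← hsupp, ← monomial_mem_iff_of_isPrime hP, hb,
      hJ.monomial_mem_sqPow_iff hm]
    refine iff_of_eq (congrArg (fun d => monomial d (1 : K) ∈ J) ?_)
    ext i
    simp only [Finsupp.add_apply, Finsupp.mapRange_apply, Finsupp.smul_apply, smul_eq_mul,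
      Finsupp.equivFunOnFinite_symm_apply_apply]
    rw [add_left_comm, Nat.mul_add_div hm, add_comm]

end MonomialIdeals

/-- Let `I` be a monomial ideal and `m ≥ 2`. Then for every `k ≥ 1`,
`Ass(R/(I^[m])^k) = Ass(R/I^k)`; consequently the index of stability of `I^[m]` equals
the index of stability of `I`. -/
theorem sqPow_stabIndex (n : ℕ) (K : Type*) [Field K]
    (I : Ideal (MvPolynomial (Fin n) K)) (hI : IsMonomialIdeal I) (m : ℕ) (hm : 2 ≤ m) :
    (∀ k : ℕ, 1 ≤ k →
      associatedPrimes (MvPolynomial (Fin n) K)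
          (MvPolynomial (Fin n) K ⧸ (sqPow m I) ^ k) =
        associatedPrimes (MvPolynomial (Fin n) K) (MvPolynomial (Fin n) K ⧸ I ^ k)) ∧
      stabIndex (sqPow m I) = stabIndex I := by
  have hAss : ∀ k : ℕ, associatedPrimes (MvPolynomial (Fin n) K)
      (MvPolynomial (Fin n) K ⧸ (sqPow m I) ^ k) =
        associatedPrimes (MvPolynomial (Fin n) K) (MvPolynomial (Fin n) K ⧸ I ^ k) := by
    intro k
    rw [← (hI.pow k).associatedPrimes_sqPow (m := m) (by omega), sqPow, sqPow, Ideal.map_pow]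
  exact ⟨fun k _ => hAss k, by simp only [stabIndex, hAss]⟩
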